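/- arXiv:1804.07635 — 3 statements merged into one kernel-verified Lean document; each statement's English description precedes it below -/
import Mathlib

section
/- Let F₁, F : ℝⁿ × ℝⁿ × S → ℝⁿ and G₁, G : ℝⁿ × ℝⁿ × S → ℝ^{n×m}, let ω > 0, let δ̄ ∈ (0,1), and let λ₁, λ₂, λ₃, λ₄ satisfy λ₁ > 2λ₃ ≥ 2(1−δ̄)λ₄ ≥ 0 and λ₂ ≥ 0. Assume that for all x, y ∈ ℝⁿ and i ∈ S: 2⟨x, F₁(x,y,i)⟩ + (1+ω)‖G₁(x,y,i)‖² ≤ −λ₁|x|² + λ₂(1−δ̄)|y|² and 2⟨x, F(x,y,i)⟩ + (1+ω⁻¹)‖G(x,y,i)‖² ≤ λ₃|x|² + λ₄(1−δ̄)|y|². Then for every r ≥ 1 the partially truncated coefficients f_r(x,y,i) = F₁(x,y,i) + F(π_r(x), π_r(y), i) and g_r(x,y,i) = G₁(x,y,i) + G(π_r(x), π_r(y), i) satisfy 2⟨x, f_r(x,y,i)⟩ + ‖g_r(x,y,i)‖² ≤ −(λ₁−2λ₃)|x|² + (1−δ̄)(λ₂+λ₄)|y|² for all x, y ∈ ℝⁿ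 and i ∈ S. -/
open scoped RealInnerProductSpace

/-- Radial projection onto the closed ball of radius `r`. -/
noncomputable def trunc {n : ℕ} (r : ℝ) (x : EuclideanSpace ℝ (Fin n)) :
    EuclideanSpace ℝ (Fin n) :=
  (min ‖x‖ r / ‖x‖) • x

theorem trunc_eq_self {n : ℕ} {r : ℝ} {x : EuclideanSpace ℝ (Fin n)} (h : ‖x‖ ≤ r) :
    trunc r x = x := by
  rcases eq_or_ne x 0 with rfl | hx
  · simp [trunc]
  · rw [trunc, min_eq_left h, div_self (norm_ne_zero_iff.2 hx), one_smul]

theorem trunc_eq_smul_of_lt {n : ℕ} {r : ℝ} {x : EuclideanSpace ℝ (Fin n)} (h : r < ‖x‖) :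
    trunc r x = (r / ‖x‖) • x := by
  rw [trunc, min_eq_right h.le]

theorem norm_trunc {n : ℕ} {r : ℝ} (hr : 0 ≤ r) (x : EuclideanSpace ℝ (Fin n)) :
    ‖trunc r x‖ = min ‖x‖ r := by
  rcases eq_or_ne x 0 with rfl | hx
  · simp [trunc, hr]
  · rw [trunc, norm_smul, Real.norm_of_nonneg (by positivity),
      div_mul_cancel₀ _ (norm_ne_zero_iff.2 hx)]

theorem norm_add_sq_le_weighted {E : Type*} [NormedAddCommGroup E] {ω : ℝ} (hω : 0 < ω) (a b : E) :
    ‖a + b‖ ^ 2 ≤ (1 + ω) * ‖a‖ ^ 2 + (1 + ω⁻¹) * ‖b‖ ^ 2 := by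
  have h : ‖a + b‖ ^ 2 ≤ (‖a‖ + ‖b‖) ^ 2 := by
    gcongr
    exact norm_add_le a b
  have hsq : 0 ≤ ω⁻¹ * (ω * ‖a‖ - ‖b‖) ^ 2 := by positivity
  have heq : ω⁻¹ * (ω * ‖a‖ - ‖b‖) ^ 2 = ω * ‖a‖ ^ 2 - 2 * ‖a‖ * ‖b‖ + ω⁻¹ * ‖b‖ ^ 2 := by
    field_simp
    ring
  linarith [add_sq ‖a‖ ‖b‖]

/-- A one-sided growth bound at the truncated arguments gives one at the original arguments. -/
theorem two_mul_inner_add_le_of_trunc {n : ℕ} {r a b K : ℝ} (hr : 0 < r) (hb : 0 ≤ b)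
    (hba : b ≤ a) (hK : 0 ≤ K) {x y v : EuclideanSpace ℝ (Fin n)}
    (h : 2 * ⟪trunc r x, v⟫ + K ≤ a * ‖trunc r x‖ ^ 2 + b * ‖trunc r y‖ ^ 2) :
    2 * ⟪x, v⟫ + K ≤ 2 * a * ‖x‖ ^ 2 + b * ‖y‖ ^ 2 := by
  have ha : 0 ≤ a := hb.trans hba
  have hy := norm_trunc hr.le y
  rcases le_or_gt ‖x‖ r with hx | hx
  · rw [trunc_eq_self hx] at h
    have hyy : b * ‖trunc r y‖ ^ 2 ≤ b * ‖y‖ ^ 2 := by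
      gcongr
      exact hy.trans_le (min_le_left _ _)
    have := mul_nonneg ha (sq_nonneg ‖x‖)
    linarith
  · have hx0 : 0 < ‖x‖ := hr.trans hx
    rw [norm_trunc hr.le x, min_eq_right hx.le, trunc_eq_smul_of_lt hx, real_inner_smul_left] at h
    have hyr : b * ‖trunc r y‖ ^ 2 ≤ a * r ^ 2 := by
      gcongr
      exact hy.trans_le (min_le_right _ _)
    set c := ‖x‖ / r with hc
    have hc1 : 1 ≤ c := (one_le_div hr).2 hx.le
    have hinner : c * (2 * (r / ‖x‖ * ⟪x, v⟫)) = 2 * ⟪x, v⟫ := by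
      rw [hc]
      field_simp
    have hcr : c * r ^ 2 ≤ ‖x‖ ^ 2 := by
      have : c * r ^ 2 = ‖x‖ * r := by
        rw [hc]
        field_simp
      rw [this, sq]
      gcongr
    have hscaled : c * (2 * (r / ‖x‖ * ⟪x, v⟫) + K) ≤ c * (2 * a * r ^ 2) := by
      gcongr
      linarith
    have hKc : K ≤ c * K := le_mul_of_one_le_left hK hc1
    have hcra := mul_le_mul_of_nonneg_left hcr ha
    have := mul_nonneg hb (sq_nonneg ‖y‖)
    linarith

theorem partially_truncated_stability_condition {n m N : ℕ}
    (F₁ F : EuclideanSpace ℝ (Fin n) → EuclideanSpace ℝ (Fin n) → Fin N → EuclideanSpace ℝ (Fin n))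
    (G₁ G : EuclideanSpace ℝ (Fin n) → EuclideanSpace ℝ (Fin n) → Fin N →
      EuclideanSpace ℝ (Fin n × Fin m))
    (ω δbar lam₁ lam₂ lam₃ lam₄ : ℝ) (hω : 0 < ω) (hδbar : δbar ∈ Set.Ioo (0 : ℝ) 1)
    (hlam₁ : 2 * lam₃ < lam₁) (hlam₃ : 2 * (1 - δbar) * lam₄ ≤ 2 * lam₃)
    (hlam₄ : 0 ≤ 2 * (1 - δbar) * lam₄) (hlam₂ : 0 ≤ lam₂)
    (hF₁ : ∀ (x y : EuclideanSpace ℝ (Fin n)) (i : Fin N),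
      2 * ⟪x, F₁ x y i⟫ + (1 + ω) * ‖G₁ x y i‖ ^ 2
        ≤ -lam₁ * ‖x‖ ^ 2 + lam₂ * (1 - δbar) * ‖y‖ ^ 2)
    (hF : ∀ (x y : EuclideanSpace ℝ (Fin n)) (i : Fin N),
      2 * ⟪x, F x y i⟫ + (1 + ω⁻¹) * ‖G x y i‖ ^ 2
        ≤ lam₃ * ‖x‖ ^ 2 + lam₄ * (1 - δbar) * ‖y‖ ^ 2) :
    ∀ r : ℝ, 1 ≤ r → ∀ (x y : EuclideanSpace ℝ (Fin n)) (i : Fin N),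
      2 * ⟪x, F₁ x y i + F (trunc r x) (trunc r y) i⟫
          + ‖G₁ x y i + G (trunc r x) (trunc r y) i‖ ^ 2
        ≤ -(lam₁ - 2 * lam₃) * ‖x‖ ^ 2 + (1 - δbar) * (lam₂ + lam₄) * ‖y‖ ^ 2 := by
  intro r hr x y i
  have hG := norm_add_sq_le_weighted hω (G₁ x y i) (G (trunc r x) (trunc r y) i)
  have hF' := two_mul_inner_add_le_of_trunc (a := lam₃) (b := lam₄ * (1 - δbar))
    (zero_lt_one.trans_le hr) (by linarith) (by linarith) (by positivity)
    (hF (trunc r x) (trunc r y) i)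
  rw [inner_add_right]
  linarith [hF₁ x y i]
end

section
/- For all real numbers x, x̄ and every real q ≥ 1, (x − x̄)(x̄⁵ − x⁵) + ((q−1)/2)·(x² − x̄²)² ≤ (q−1)²·(x − x̄)². -/
theorem one_sided_lipschitz_mode1 (q : ℝ) (hq : 1 ≤ q) (x xb : ℝ) :
    (x - xb) * (xb ^ 5 - x ^ 5) + (q - 1) / 2 * (x ^ 2 - xb ^ 2) ^ 2
      ≤ (q - 1) ^ 2 * (x - xb) ^ 2 := by
  have h : 0 ≤ (x - xb) ^ 2 * (((q - 1) - (x + xb) ^ 2 / 4) ^ 2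
      + (4 * (x + xb) ^ 4 + 10 * (x + xb) ^ 2 * (x - xb) ^ 2 + (x - xb) ^ 4) / 16) := by
    positivity
  linear_combination h
end

section
/- For every real q ≥ 1 and all real x, x̄, y, ȳ, (x − x̄)·[(−x⁵ + y/(1+y²)) − (−x̄⁵ + ȳ/(1+ȳ²))] + ((q−1)/2)·(sin x · sin y − sin x̄ · sin ȳ)² ≤ q·((x − x̄)² + (y − ȳ)²). -/
theorem sin_mul_sin_sub_sq_le (x x' y y' : ℝ) :
    (Real.sin x * Real.sin y - Real.sin x' * Real.sin y') ^ 2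
      ≤ 2 * ((x - x') ^ 2 + (y - y') ^ 2) := by
  calc (Real.sin x * Real.sin y - Real.sin x' * Real.sin y') ^ 2
      = ((Real.sin x - Real.sin x') * Real.sin y
          + Real.sin x' * (Real.sin y - Real.sin y')) ^ 2 := by ring
    _ ≤ 2 * (((Real.sin x - Real.sin x') * Real.sin y) ^ 2
          + (Real.sin x' * (Real.sin y - Real.sin y')) ^ 2) := add_sq_le
    _ = 2 * ((Real.sin x - Real.sin x') ^ 2 * Real.sin y ^ 2
          + Real.sin x' ^ 2 * (Real.sin y - Real.sin y') ^ 2) := by ring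
    _ ≤ 2 * ((x - x') ^ 2 * 1 + 1 * (y - y') ^ 2) := by
      exact mul_le_mul_of_nonneg_left (add_le_add
        (mul_le_mul (sq_le_sq.2 (Real.abs_sin_sub_sin_le x x')) (Real.sin_sq_le_one y)
          (sq_nonneg _) (sq_nonneg _))
        (mul_le_mul (Real.sin_sq_le_one x') (sq_le_sq.2 (Real.abs_sin_sub_sin_le y y'))
          (sq_nonneg _) zero_le_one)) zero_le_two
    _ = 2 * ((x - x') ^ 2 + (y - y') ^ 2) := by ring

theorem div_one_add_sq_sub_sq_le (y z : ℝ) :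
    (y / (1 + y ^ 2) - z / (1 + z ^ 2)) ^ 2 ≤ (y - z) ^ 2 := by
  have hP : 1 ≤ (1 + y ^ 2) * (1 + z ^ 2) := by
    nlinarith [sq_nonneg y, sq_nonneg z, sq_nonneg (y * z)]
  have hfactor : y / (1 + y ^ 2) - z / (1 + z ^ 2)
      = (y - z) * ((1 - y * z) / ((1 + y ^ 2) * (1 + z ^ 2))) := by
    have hy : 1 + y ^ 2 ≠ 0 := by positivity
    have hz : 1 + z ^ 2 ≠ 0 := by positivity
    field_simp
    ring
  have hle : ((1 - y * z) / ((1 + y ^ 2) * (1 + z ^ 2))) ^ 2 ≤ 1 := by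
    rw [div_pow, div_le_one (by positivity)]
    calc (1 - y * z) ^ 2 ≤ (1 + y ^ 2) * (1 + z ^ 2) := by nlinarith [sq_nonneg (y + z)]
      _ ≤ ((1 + y ^ 2) * (1 + z ^ 2)) ^ 2 := le_self_pow₀ hP two_ne_zero
  rw [hfactor, mul_pow]
  exact mul_le_of_le_one_right (sq_nonneg _) hle

theorem sub_mul_pow_sub_pow_nonneg_of_odd {n : ℕ} (hn : Odd n) (x y : ℝ) :
    0 ≤ (x - y) * (x ^ n - y ^ n) := by
  rcases le_total x y with h | h
  · exact mul_nonneg_of_nonpos_of_nonpos (sub_nonpos.2 h)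
      (sub_nonpos.2 (hn.strictMono_pow.monotone h))
  · exact mul_nonneg (sub_nonneg.2 h) (sub_nonneg.2 (hn.strictMono_pow.monotone h))

theorem one_sided_lipschitz_mode2 (q : ℝ) (hq : 1 ≤ q) (x xb y yb : ℝ) :
    (x - xb) * ((-x ^ 5 + y / (1 + y ^ 2)) - (-xb ^ 5 + yb / (1 + yb ^ 2)))
        + (q - 1) / 2 * (Real.sin x * Real.sin y - Real.sin xb * Real.sin yb) ^ 2
      ≤ q * ((x - xb) ^ 2 + (y - yb) ^ 2) := by
  have hpow := sub_mul_pow_sub_pow_nonneg_of_odd (n := 5) (by decide) x xb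
  have hdiv := div_one_add_sq_sub_sq_le y yb
  have hsin := mul_le_mul_of_nonneg_left (sin_mul_sin_sub_sq_le x xb y yb)
    (by linarith : 0 ≤ (q - 1) / 2)
  have hyoung := two_mul_le_add_sq (x - xb) (y / (1 + y ^ 2) - yb / (1 + yb ^ 2))
  have hx := sq_nonneg (x - xb)
  have hy := sq_nonneg (y - yb)
  linarith
end
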